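/- arXiv:1506.03711 — 5 statements merged into one kernel-verified Lean document; each statement's English description precedes it below -/
import Mathlib

section
/- Let R be a ring, M an R-module, and let d, h : M → M be R-linear endomorphisms with d ∘ d = 0. Define E := id_M − (d ∘ h + h ∘ d), and assume E is locally nilpotent, i.e. for every x ∈ M there exists n ∈ ℕ with E^n x = 0. Then there exists an R-linear endomorphism G : M → M satisfying d ∘ G + G ∘ d = id_M (namely, G x can be taken to be the stabilized partial sum Σ_{k=0}^{n−1} E^k (h x) for any n with E^n (h x) = 0). -/
/-- Kontsevich–Positselski contraction: if `d ∘ d = 0` and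
`E = id - (d ∘ h + h ∘ d)` is locally nilpotent, then `d` admits a contracting
homotopy `G`, given on each `x` by the stabilized partial sums
`∑_{k<n} E^k (h x)` for any `n` with `E^n (h x) = 0`. -/
theorem stmt_1 {R M : Type*} [Ring R] [AddCommGroup M] [Module R M]
    (d h : Module.End R M) (hd : d * d = 0)
    (hE : ∀ x : M, ∃ n : ℕ, ((1 - (d * h + h * d)) ^ n) x = 0) :
    ∃ G : Module.End R M, d * G + G * d = 1 ∧
      ∀ (x : M) (n : ℕ), ((1 - (d * h + h * d)) ^ n) (h x) = 0 →
        G x = ∑ k ∈ Finset.range n, ((1 - (d * h + h * d)) ^ k) (h x) := by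
  generalize hEE : (1 - (d * h + h * d) : Module.End R M) = E at hE ⊢
  have hA : d * h + h * d = 1 - E := by rw [← hEE]; abel
  have hcomm : d * (1 - E) = (1 - E) * d := by
    rw [← hA, mul_add, add_mul, ← mul_assoc, hd, zero_mul, mul_assoc h d d, hd, mul_zero,
      zero_add, add_zero, mul_assoc]
  have h1 : ∀ (n : ℕ) (y : M), (E ^ n) y = 0 →
      (1 - E) (∑ k ∈ Finset.range n, (E ^ k) y) = y := by
    intro n y hy
    have := congrArg (fun f : Module.End R M => f y) (mul_neg_geom_sum E n)
    simpa [Module.End.mul_apply, LinearMap.sum_apply, hy, -mul_neg_geom_sum] using this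
  have hinj : Function.Injective (1 - E : Module.End R M) := by
    rw [injective_iff_map_eq_zero]
    intro y hy
    obtain ⟨n, hn⟩ := hE y
    have := congrArg (fun f : Module.End R M => f y) (geom_sum_mul_neg E n)
    simp only [Module.End.mul_apply, hy, map_zero] at this
    simpa [hn] using this.symm
  have hsurj : Function.Surjective (1 - E : Module.End R M) := by
    intro y
    obtain ⟨n, hn⟩ := hE y
    exact ⟨_, h1 n y hn⟩
  let e := LinearEquiv.ofBijective (1 - E : Module.End R M) ⟨hinj, hsurj⟩
  let S : Module.End R M := e.symm.toLinearMap
  have hS : ∀ y, (1 - E) (S y) = y := fun y => e.apply_symm_apply y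
  refine ⟨S * h, ?_, ?_⟩
  · ext x
    apply hinj
    have hc : (1 - E) (d (S (h x))) = d ((1 - E) (S (h x))) :=
      (congrArg (fun f : Module.End R M => f (S (h x))) hcomm).symm
    have hx : d (h x) + h (d x) = (1 - E) x :=
      congrArg (fun f : Module.End R M => f x) hA
    rw [LinearMap.add_apply, map_add]
    simp only [Module.End.mul_apply, Module.End.one_apply]
    rw [hc, hS, hS, hx]
  · intro x n hn
    apply hinj
    rw [h1 n _ hn]
    exact hS _
end

section
/- Let R be a ring, M an R-module, and let d, h : M → M be R-linear endomorphisms with d ∘ d = 0. Define E := id_M − (d ∘ h + h ∘ d). Suppose there is a monotone family of submodules F : ℕ → Submodule(R, M) with ⨆_{n} F(n) = M (exhaustive filtration), such that E x = 0 for all x ∈ F(0) and E x ∈ F(n) for all x ∈ F(n+1) and all n. Then E is locally nilpotent (for every x there is n with E^n x = 0), and consequently there exists an R-linear endomorphism G : M → M with d ∘ G + G ∘ d = id_M. -/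
/-- If `d ∘ d = 0`, and there is a monotone exhaustive filtration `F` of `M` with
`E = id - (d ∘ h + h ∘ d)` vanishing on `F 0` and mapping `F (n+1)` into `F n`,
then `E` is locally nilpotent and `d` admits a contracting homotopy. -/
theorem stmt_2 {R M : Type*} [Ring R] [AddCommGroup M] [Module R M]
    (d h : Module.End R M) (hd : d * d = 0)
    (F : ℕ → Submodule R M) (hmono : Monotone F) (hexh : (⨆ n, F n) = ⊤)
    (hE0 : ∀ x ∈ F 0, (1 - (d * h + h * d)) x = 0)
    (hEstep : ∀ n : ℕ, ∀ x ∈ F (n + 1), (1 - (d * h + h * d)) x ∈ F n) :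
    (∀ x : M, ∃ n : ℕ, ((1 - (d * h + h * d)) ^ n) x = 0) ∧
      ∃ G : Module.End R M, d * G + G * d = 1 := by
  have key : ∀ n : ℕ, ∀ x ∈ F n, ((1 - (d * h + h * d)) ^ (n + 1)) x = 0 := by
    intro n
    induction n with
    | zero => intro x hx; rw [zero_add, pow_one]; exact hE0 x hx
    | succ k ih =>
      intro x hx
      rw [pow_succ, Module.End.mul_apply]
      exact ih _ (hEstep k x hx)
  have nil : ∀ x : M, ∃ n : ℕ, ((1 - (d * h + h * d)) ^ n) x = 0 := by
    intro x
    have hx : x ∈ ⨆ n, F n := by rw [hexh]; trivial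
    obtain ⟨n, hn⟩ := (Submodule.mem_iSup_of_directed F hmono.directed_le).1 hx
    exact ⟨n + 1, key n x hn⟩
  refine ⟨nil, ?_⟩
  obtain ⟨P, hP⟩ : ∃ P, P = d * h + h * d := ⟨_, rfl⟩
  rw [← hP] at nil
  have hbij : Function.Bijective P := by
    constructor
    · rw [injective_iff_map_eq_zero]
      intro x hx
      obtain ⟨n, hn⟩ := nil x
      have e := congrArg (fun f : Module.End R M => f x) (geom_sum_mul_neg (1 - P) n)
      simp only [sub_sub_cancel, Module.End.mul_apply, hx, map_zero, LinearMap.sub_apply, hn,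
        Module.End.one_apply, sub_zero] at e
      exact e.symm
    · intro y
      obtain ⟨n, hn⟩ := nil y
      have e := congrArg (fun f : Module.End R M => f y) (mul_neg_geom_sum (1 - P) n)
      rw [sub_sub_cancel] at e
      refine ⟨_, e.trans ?_⟩
      simp only [LinearMap.sub_apply, hn, Module.End.one_apply, sub_zero]
  obtain ⟨u, hu⟩ := (Module.End.isUnit_iff P).2 hbij
  have hc : Commute d (u : Module.End R M) := by
    rw [hu, hP]
    change d * (d * h + h * d) = (d * h + h * d) * d
    rw [mul_add, add_mul, ← mul_assoc, hd, mul_assoc h d d, hd]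
    simp [mul_assoc]
  have hc' := hc.units_inv_right
  refine ⟨h * (↑u⁻¹ : Module.End R M), ?_⟩
  rw [mul_assoc h, ← hc'.eq, ← mul_assoc, ← mul_assoc, ← add_mul, ← hP, ← hu, Units.mul_inv]
end

section
/- Let R be a ring, M an R-module, and let d, B, h : M → M be R-linear endomorphisms satisfying d ∘ d = 0, B ∘ B = 0, d ∘ B + B ∘ d = 0, and d ∘ h + h ∘ d = id_M. Assume that B ∘ h + h ∘ B is locally nilpotent, i.e. for every x ∈ M there exists n ∈ ℕ with (B ∘ h + h ∘ B)^n x = 0. Then there exists an R-linear endomorphism G : M → M with (d + B) ∘ G + G ∘ (d + B) = id_M; that is, the perturbed differential d + B also admits a contracting homotopy. -/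
/-- Homological perturbation: if `d` and `B` are anticommuting square-zero
endomorphisms, `h` is a contracting homotopy for `d`, and `B ∘ h + h ∘ B` is
locally nilpotent, then the perturbed differential `d + B` also admits a
contracting homotopy. -/
theorem stmt_3 {R M : Type*} [Ring R] [AddCommGroup M] [Module R M]
    (d B h : Module.End R M) (hd : d * d = 0) (hB : B * B = 0)
    (hdB : d * B + B * d = 0) (hh : d * h + h * d = 1)
    (hn : ∀ x : M, ∃ n : ℕ, ((B * h + h * B) ^ n) x = 0) :
    ∃ G : Module.End R M, (d + B) * G + G * (d + B) = 1 := by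
  set N : Module.End R M := B * h + h * B with hN
  have hinj : Function.Injective (1 + N : Module.End R M) := by
    rw [injective_iff_map_eq_zero]
    intro x hx
    have hx' : N x = -x := by
      have h1 : x + N x = 0 := hx
      exact (neg_eq_of_add_eq_zero_right h1).symm
    obtain ⟨n, hnx⟩ := hn x
    induction n with
    | zero => simpa using hnx
    | succ k ih =>
      apply ih
      rw [pow_succ, Module.End.mul_apply, hx', map_neg, neg_eq_zero] at hnx
      exact hnx
  have hsurj : Function.Surjective (1 + N : Module.End R M) := by
    intro x
    obtain ⟨n, hnx⟩ := hn x
    induction n generalizing x with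
    | zero => exact ⟨0, by rw [map_zero]; simpa using hnx.symm⟩
    | succ k ih =>
      rw [pow_succ, Module.End.mul_apply] at hnx
      obtain ⟨y, hy⟩ := ih (N x) hnx
      refine ⟨x - y, ?_⟩
      rw [map_sub, hy]
      simp
  have hu : IsUnit (1 + N : Module.End R M) :=
    (Module.End.isUnit_iff _).2 ⟨hinj, hsurj⟩
  obtain ⟨u, hu⟩ := hu
  have hD : (d + B) * (d + B) = 0 := by
    have : (d + B) * (d + B) = d * d + (d * B + B * d) + B * B := by noncomm_ring
    rw [this, hd, hdB, hB]; simp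
  have hU : (d + B) * h + h * (d + B) = u := by
    rw [hu, ← hh, hN]; noncomm_ring
  have hc : Commute (d + B) (u : Module.End R M) := by
    rw [← hU]
    change _ * _ = _ * _
    generalize d + B = D at hD
    rw [mul_add, add_mul, ← mul_assoc, hD, mul_assoc h, hD, mul_assoc]; simp
  have hc' := hc.units_inv_right
  refine ⟨h * (↑u⁻¹ : Module.End R M), ?_⟩
  rw [mul_assoc h, ← hc'.eq, ← mul_assoc, ← mul_assoc, ← add_mul, hU, Units.mul_inv]
end

section
/- Let R be a commutative ring and A, A', A'' be R-modules. For a family f = (f_i : A^{⊗i} → A')_{i ≥ 1} of R-linear maps (tensor powers over R), define its geometric-series extension F : ⨁_{n≥0} A^{⊗n} → ⨁_{m≥0} A'^{⊗m} to be the identity on the degree-0 summand A^{⊗0} = R and, on A^{⊗n} for n ≥ 1, to be the sum over all k ≥ 1 and all compositions n = i_1 + ⋯ + i_k with each i_j ≥ 1 of the map f_{i_1} ⊗ ⋯ ⊗ f_{i_k} : A^{⊗n} ≅ A^{⊗i_1} ⊗ ⋯ ⊗ A^{⊗i_k} → A'^{⊗k}. Given also a family g = (g_j : A'^{⊗j}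 → A'')_{j ≥ 1}, define the composite family h = (h_n)_{n ≥ 1} by h_n := Σ over k ≥ 1 and compositions n = i_1 + ⋯ + i_k of g_k ∘ (f_{i_1} ⊗ ⋯ ⊗ f_{i_k}) : A^{⊗n} → A''. Then the geometric-series extension H of h satisfies H = G ∘ F, where G is the geometric-series extension of g. -/
open scoped DirectSum TensorProduct
open PiTensorProduct

theorem aux_congr {X Y : Type} (p : (n : ℕ) → (Fin n → X) → Y) {m n : ℕ} {v : Fin m → X}
    {w : Fin n → X} (h1 : m = n)
    (h2 : ∀ (i : ℕ) (him : i < m) (hin : i < n), v ⟨i, him⟩ = w ⟨i, hin⟩) : p m v = p n w := by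
  subst h1
  congr 1
  funext i
  exact h2 i i.2 i.2

/-- Multiplicativity of geometric-series extensions: if `F`, `G`, `H` are the
geometric-series extensions (on tensor modules `⨁ n, A^{⊗n}`) of the families
`f`, `g` and of the composite family `h` (where `h_n` is the sum over all
compositions `n = i_1 + ⋯ + i_k` of `g_k ∘ (f_{i_1} ⊗ ⋯ ⊗ f_{i_k})`),
then `H = G ∘ F`.  Here a family `(φ_i)_{i ≥ 1}` is encoded as multilinear maps,
its geometric-series extension being characterized on pure tensors as the sum
over all compositions of `n` of the tensor of the values of `φ` on the blocks
(for `n = 0` this is the identity of the degree-0 summand). -/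
theorem stmt_5 {R A A' A'' : Type} [CommRing R]
    [AddCommGroup A] [Module R A] [AddCommGroup A'] [Module R A']
    [AddCommGroup A''] [Module R A'']
    (f : (n : ℕ) → MultilinearMap R (fun _ : Fin n => A) A')
    (g : (n : ℕ) → MultilinearMap R (fun _ : Fin n => A') A'')
    (h : (n : ℕ) → MultilinearMap R (fun _ : Fin n => A) A'')
    (F : (⨁ n : ℕ, ⨂[R] (_ : Fin n), A) →ₗ[R] ⨁ n : ℕ, ⨂[R] (_ : Fin n), A')
    (G : (⨁ n : ℕ, ⨂[R] (_ : Fin n), A') →ₗ[R] ⨁ n : ℕ, ⨂[R] (_ : Fin n), A'')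
    (H : (⨁ n : ℕ, ⨂[R] (_ : Fin n), A) →ₗ[R] ⨁ n : ℕ, ⨂[R] (_ : Fin n), A'')
    (hF : ∀ (n : ℕ) (a : Fin n → A),
      F (DirectSum.of (fun n : ℕ => ⨂[R] (_ : Fin n), A) n (tprod R a)) =
        ∑ c : Composition n,
          DirectSum.of (fun m : ℕ => ⨂[R] (_ : Fin m), A') c.length
            (tprod R fun j => f (c.blocksFun j) (a ∘ c.embedding j)))
    (hG : ∀ (n : ℕ) (a : Fin n → A'),
      G (DirectSum.of (fun n : ℕ => ⨂[R] (_ : Fin n), A') n (tprod R a)) =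
        ∑ c : Composition n,
          DirectSum.of (fun m : ℕ => ⨂[R] (_ : Fin m), A'') c.length
            (tprod R fun j => g (c.blocksFun j) (a ∘ c.embedding j)))
    (hH : ∀ (n : ℕ) (a : Fin n → A),
      H (DirectSum.of (fun n : ℕ => ⨂[R] (_ : Fin n), A) n (tprod R a)) =
        ∑ c : Composition n,
          DirectSum.of (fun m : ℕ => ⨂[R] (_ : Fin m), A'') c.length
            (tprod R fun j => h (c.blocksFun j) (a ∘ c.embedding j)))
    (hcomp : ∀ (n : ℕ), 0 < n → ∀ (a : Fin n → A),
      h n a = ∑ c : Composition n,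
        g c.length (fun j => f (c.blocksFun j) (a ∘ c.embedding j))) :
    H = G ∘ₗ F := by
  apply DirectSum.linearMap_ext
  intro n
  apply PiTensorProduct.ext
  refine MultilinearMap.ext fun a => ?_
  change H (DirectSum.of (fun n : ℕ => ⨂[R] (_ : Fin n), A) n (tprod R a)) =
    G (F (DirectSum.of (fun n : ℕ => ⨂[R] (_ : Fin n), A) n (tprod R a)))
  rw [hF, hH, map_sum]
  simp only [hG]
  have key : ∀ c : Composition n,
      DirectSum.of (fun m : ℕ => ⨂[R] (_ : Fin m), A'') c.length
        (tprod R fun j => h (c.blocksFun j) (a ∘ c.embedding j)) =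
      ∑ d : (∀ i : Fin c.length, Composition (c.blocksFun i)),
        DirectSum.of (fun m : ℕ => ⨂[R] (_ : Fin m), A'') c.length
          (tprod R fun j => g (d j).length (fun k => f ((d j).blocksFun k)
            ((a ∘ c.embedding j) ∘ (d j).embedding k))) := by
    intro c
    rw [← map_sum]
    congr 1
    rw [← MultilinearMap.map_sum (PiTensorProduct.tprod R) (fun (j : Fin c.length)
      (d : Composition (c.blocksFun j)) => g d.length (fun k => f (d.blocksFun k)
            ((a ∘ c.embedding j) ∘ d.embedding k)))]
    congr 1
    funext j
    exact hcomp _ (c.one_le_blocksFun j) _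
  rw [Finset.sum_congr rfl (fun c _ => key c), Finset.sum_sigma', Finset.sum_sigma',
    Finset.univ_sigma_univ, Finset.univ_sigma_univ, ← (Composition.sigmaEquivSigmaPi n).sum_comp]
  apply Finset.sum_congr rfl
  rintro ⟨x, b⟩ _
  refine aux_congr (fun m v => DirectSum.of (fun m : ℕ => ⨂[R] (_ : Fin m), A'') m (tprod R v))
    (Composition.length_gather x b) ?_
  intro i hi1 hi2
  refine aux_congr (fun m v => g m v) (Composition.length_sigmaCompositionAux x b ⟨i, hi2⟩) ?_
  intro j hj1 hj2
  refine aux_congr (fun m v => f m v)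
    (Composition.blocksFun_sigmaCompositionAux x b ⟨i, hi2⟩ ⟨j, hj2⟩) ?_
  intro k hk1 hk2
  refine congr_arg a (Fin.ext ?_)
  have := Composition.sizeUpTo_sizeUpTo_add x b hi2 hj2
  change (x.gather b).sizeUpTo i + ((x.sigmaCompositionAux b ⟨i, hi1⟩).sizeUpTo j + k) =
    x.sizeUpTo (b.sizeUpTo i + j) + k
  rw [this, add_assoc]
end

section
/- Let R be a commutative ring and let V, M, M', M'' be R-modules; write T(V) = ⨁_{n≥0} V^{⊗n}. For an R-linear map φ : M ⊗ T(V) → M', define its deconcatenation extension Φ : M ⊗ T(V) → M' ⊗ T(V) to be the R-linear map which on M ⊗ V^{⊗n} sends m ⊗ (v_1 ⊗ ⋯ ⊗ v_n) to Σ_{k=0}^{n} φ(m ⊗ (v_1 ⊗ ⋯ ⊗ v_k)) ⊗ (v_{k+1} ⊗ ⋯ ⊗ v_n). Then for R-linear maps φ : M ⊗ T(V) → M' and ψ : M' ⊗ T(V) → M'', setting θ := ψ ∘ Φ : M ⊗ T(V) → M'', the deconcatenation extensions satisfy Θ = Ψ ∘ Φ. -/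
open scoped DirectSum TensorProduct
open PiTensorProduct

/-- The word `u 0 ⊗ ⋯ ⊗ u (n-1)` in the tensor module. -/
noncomputable def wordOf (R : Type) {V : Type} [CommRing R] [AddCommGroup V] [Module R V]
    (u : ℕ → V) (n : ℕ) : ⨁ n : ℕ, ⨂[R] (_ : Fin n), V :=
  DirectSum.of (fun n : ℕ => ⨂[R] (_ : Fin n), V) n (tprod R fun i : Fin n => u i)

theorem ext_wordOf {R V M M' : Type} [CommRing R]
    [AddCommGroup V] [Module R V] [AddCommGroup M] [Module R M]
    [AddCommGroup M'] [Module R M']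
    (f g : (M ⊗[R] ⨁ n : ℕ, ⨂[R] (_ : Fin n), V) →ₗ[R] M')
    (h : ∀ (n : ℕ) (m : M) (u : ℕ → V), f (m ⊗ₜ[R] wordOf R u n) = g (m ⊗ₜ[R] wordOf R u n)) :
    f = g := by
  apply TensorProduct.ext
  ext m : 1
  apply DirectSum.linearMap_ext
  intro n
  apply PiTensorProduct.ext
  ext v
  have := h n m (fun i => if hi : i < n then v ⟨i, hi⟩ else 0)
  simp only [wordOf, Fin.is_lt, dite_true, Fin.eta] at this
  exact this

theorem wordOf_formula {R V M M' : Type} [CommRing R]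
    [AddCommGroup V] [Module R V] [AddCommGroup M] [Module R M]
    [AddCommGroup M'] [Module R M']
    (φ : (M ⊗[R] ⨁ n : ℕ, ⨂[R] (_ : Fin n), V) →ₗ[R] M')
    (Φ : (M ⊗[R] ⨁ n : ℕ, ⨂[R] (_ : Fin n), V) →ₗ[R]
      M' ⊗[R] ⨁ n : ℕ, ⨂[R] (_ : Fin n), V)
    (hΦ : ∀ (n : ℕ) (m : M) (v : Fin n → V),
      Φ (m ⊗ₜ[R] DirectSum.of (fun n : ℕ => ⨂[R] (_ : Fin n), V) n (tprod R v)) =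
        ∑ k : Fin (n + 1),
          φ (m ⊗ₜ[R] DirectSum.of (fun n : ℕ => ⨂[R] (_ : Fin n), V) (k : ℕ)
              (tprod R fun i : Fin (k : ℕ) => v (Fin.castLE k.is_le i))) ⊗ₜ[R]
            DirectSum.of (fun n : ℕ => ⨂[R] (_ : Fin n), V) (n - (k : ℕ))
              (tprod R fun i : Fin (n - (k : ℕ)) =>
                v (Fin.cast (Nat.add_sub_cancel' k.is_le) (Fin.natAdd (k : ℕ) i))))
    (n : ℕ) (m : M) (u : ℕ → V) :
    Φ (m ⊗ₜ[R] wordOf R u n) = ∑ k ∈ Finset.range (n + 1),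
      φ (m ⊗ₜ[R] wordOf R u k) ⊗ₜ[R] wordOf R (fun i => u (k + i)) (n - k) := by
  rw [Finset.sum_range]
  exact hΦ n m (fun i => u i)

/-- Compatibility of deconcatenation extensions with composition: write
`T V = ⨁ n, V^{⊗n}`.  The deconcatenation extension of `φ : M ⊗ T V → M'` is the
linear map `Φ : M ⊗ T V → M' ⊗ T V` sending `m ⊗ (v_1 ⊗ ⋯ ⊗ v_n)` to
`∑_{k=0}^n φ(m ⊗ (v_1 ⊗ ⋯ ⊗ v_k)) ⊗ (v_{k+1} ⊗ ⋯ ⊗ v_n)`.  If `Φ`, `Ψ`, `Θ` are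
the deconcatenation extensions of `φ`, `ψ` and of `θ = ψ ∘ Φ`, then `Θ = Ψ ∘ Φ`. -/
theorem stmt_6 {R V M M' M'' : Type} [CommRing R]
    [AddCommGroup V] [Module R V] [AddCommGroup M] [Module R M]
    [AddCommGroup M'] [Module R M'] [AddCommGroup M''] [Module R M'']
    (φ : (M ⊗[R] ⨁ n : ℕ, ⨂[R] (_ : Fin n), V) →ₗ[R] M')
    (ψ : (M' ⊗[R] ⨁ n : ℕ, ⨂[R] (_ : Fin n), V) →ₗ[R] M'')
    (θ : (M ⊗[R] ⨁ n : ℕ, ⨂[R] (_ : Fin n), V) →ₗ[R] M'')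
    (Φ : (M ⊗[R] ⨁ n : ℕ, ⨂[R] (_ : Fin n), V) →ₗ[R]
      M' ⊗[R] ⨁ n : ℕ, ⨂[R] (_ : Fin n), V)
    (Ψ : (M' ⊗[R] ⨁ n : ℕ, ⨂[R] (_ : Fin n), V) →ₗ[R]
      M'' ⊗[R] ⨁ n : ℕ, ⨂[R] (_ : Fin n), V)
    (Θ : (M ⊗[R] ⨁ n : ℕ, ⨂[R] (_ : Fin n), V) →ₗ[R]
      M'' ⊗[R] ⨁ n : ℕ, ⨂[R] (_ : Fin n), V)
    (hΦ : ∀ (n : ℕ) (m : M) (v : Fin n → V),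
      Φ (m ⊗ₜ[R] DirectSum.of (fun n : ℕ => ⨂[R] (_ : Fin n), V) n (tprod R v)) =
        ∑ k : Fin (n + 1),
          φ (m ⊗ₜ[R] DirectSum.of (fun n : ℕ => ⨂[R] (_ : Fin n), V) (k : ℕ)
              (tprod R fun i : Fin (k : ℕ) => v (Fin.castLE k.is_le i))) ⊗ₜ[R]
            DirectSum.of (fun n : ℕ => ⨂[R] (_ : Fin n), V) (n - (k : ℕ))
              (tprod R fun i : Fin (n - (k : ℕ)) =>
                v (Fin.cast (Nat.add_sub_cancel' k.is_le) (Fin.natAdd (k : ℕ) i))))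
    (hΨ : ∀ (n : ℕ) (m : M') (v : Fin n → V),
      Ψ (m ⊗ₜ[R] DirectSum.of (fun n : ℕ => ⨂[R] (_ : Fin n), V) n (tprod R v)) =
        ∑ k : Fin (n + 1),
          ψ (m ⊗ₜ[R] DirectSum.of (fun n : ℕ => ⨂[R] (_ : Fin n), V) (k : ℕ)
              (tprod R fun i : Fin (k : ℕ) => v (Fin.castLE k.is_le i))) ⊗ₜ[R]
            DirectSum.of (fun n : ℕ => ⨂[R] (_ : Fin n), V) (n - (k : ℕ))
              (tprod R fun i : Fin (n - (k : ℕ)) =>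
                v (Fin.cast (Nat.add_sub_cancel' k.is_le) (Fin.natAdd (k : ℕ) i))))
    (hΘ : ∀ (n : ℕ) (m : M) (v : Fin n → V),
      Θ (m ⊗ₜ[R] DirectSum.of (fun n : ℕ => ⨂[R] (_ : Fin n), V) n (tprod R v)) =
        ∑ k : Fin (n + 1),
          θ (m ⊗ₜ[R] DirectSum.of (fun n : ℕ => ⨂[R] (_ : Fin n), V) (k : ℕ)
              (tprod R fun i : Fin (k : ℕ) => v (Fin.castLE k.is_le i))) ⊗ₜ[R]
            DirectSum.of (fun n : ℕ => ⨂[R] (_ : Fin n), V) (n - (k : ℕ))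
              (tprod R fun i : Fin (n - (k : ℕ)) =>
                v (Fin.cast (Nat.add_sub_cancel' k.is_le) (Fin.natAdd (k : ℕ) i))))
    (hθ : θ = ψ ∘ₗ Φ) :
    Θ = Ψ ∘ₗ Φ := by
  apply ext_wordOf
  intro n m u
  have h1 := wordOf_formula φ Φ hΦ
  have h2 := wordOf_formula ψ Ψ hΨ
  have h3 := wordOf_formula θ Θ hΘ
  rw [h3, LinearMap.comp_apply, h1, map_sum, hθ]
  simp only [LinearMap.comp_apply, h1, h2, map_sum, TensorProduct.sum_tmul]
  rw [Finset.sum_sigma', Finset.sum_sigma']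
  refine Finset.sum_bij' (fun x _ => ⟨x.2, x.1 - x.2⟩) (fun x _ => ⟨x.1 + x.2, x.1⟩)
    ?_ ?_ ?_ ?_ ?_
  · rintro ⟨k, j⟩ h
    simp only [Finset.mem_sigma, Finset.mem_range] at h ⊢
    omega
  · rintro ⟨k, j⟩ h
    simp only [Finset.mem_sigma, Finset.mem_range] at h ⊢
    omega
  · rintro ⟨k, j⟩ h
    simp only [Finset.mem_sigma, Finset.mem_range] at h ⊢
    have : j + (k - j) = k := by omega
    simp [this]
  · rintro ⟨k, j⟩ h
    simp
  · rintro ⟨k, j⟩ h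
    simp only [Finset.mem_sigma, Finset.mem_range] at h ⊢
    obtain ⟨l, rfl⟩ : ∃ l, k = j + l := ⟨k - j, by omega⟩
    simp only [Nat.add_sub_cancel_left, Nat.sub_sub, add_assoc]
end
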